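/- Let V be a real vector space of dimension 4 equipped with a nondegenerate alternating bilinear form ω, let I ⊆ ℝ be an open interval containing 0, and let ε : I → V be a smooth curve such that for every t ∈ I: the vectors ε(t), ε'(t), ε''(t), ε⁽³⁾(t) form a basis of V, ω(ε(t), ε'(t)) = 0, and ε⁽⁴⁾(t) = B₀(t)·ε(t) for a smooth function B₀ : I → ℝ. Let ℓ = span{ε(0)}, Π : V → V/ℓ the canonical projection, and η the smooth curve near 0 with η(t) = t⁻¹·Π(ε(t)) for t ≠ 0 and η(0) = Π(ε'(0)). Suppose J ⊆ ℝ is an open interval containing 0, ψ : J → I a smooth map with ψ(0) = 0 and ψ'(τ) ≠ 0 for all τ, g : J → ℝ a smooth nowhere-vanishing function, such that the curve ζ(τ) = g(τ)·η(ψ(τ)) satisfies ζ⁽³⁾(τ) = b₀(τ)·ζ(τ) for a smooth function b₀ : J → ℝ. Then b₀(0) = 0. -/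

import Mathlib

open Topology Filter

section

open scoped ContDiff

theorem ContDiffOn.exists_contDiff_eventuallyEq {E : Type*} [NormedAddCommGroup E]
    [NormedSpace ℝ E] {f : ℝ → E} {s : Set ℝ} {a : ℝ} (hs : IsOpen s) (ha : a ∈ s)
    (hf : ContDiffOn ℝ ∞ f s) : ∃ F : ℝ → E, ContDiff ℝ ∞ F ∧ F =ᶠ[𝓝 a] f := by
  obtain ⟨r, hr, hrs⟩ := Metric.nhds_basis_closedBall.mem_iff.1 (hs.mem_nhds ha)
  let χ : ContDiffBump a := ⟨r / 2, r, by positivity, by linarith⟩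
  refine ⟨fun t => χ t • f t, contDiff_iff_contDiffAt.2 fun x => ?_, ?_⟩
  · by_cases hx : x ∈ s
    · exact χ.contDiffAt.smul (hf.contDiffAt (hs.mem_nhds hx))
    · have hx' : x ∉ tsupport χ := fun h => hx (hrs (by rwa [χ.tsupport_eq] at h))
      refine (contDiffAt_const (c := (0 : E))).congr_of_eventuallyEq ?_
      filter_upwards [notMem_tsupport_iff_eventuallyEq.1 hx'] with y hy
      simp [hy]
  · filter_upwards [χ.eventuallyEq_one] with t ht
    simp [ht]

theorem contDiff_integral_pow_smul {E : Type*} [NormedAddCommGroup E] [NormedSpace ℝ E]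
    (n k : ℕ) {f : ℝ → E} (hf : ContDiff ℝ n f) :
    ContDiff ℝ n fun t => ∫ s in (0 : ℝ)..1, s ^ k • f (s * t) := by
  induction n generalizing k f with
  | zero =>
    have hc : Continuous f := hf.continuous
    refine contDiff_zero.2 ?_
    exact intervalIntegral.continuous_parametric_intervalIntegral_of_continuous'
      (f := fun t s : ℝ => s ^ k • f (s * t)) (by unfold Function.uncurry; fun_prop) 0 1
  | succ n ih =>
    push_cast at hf ⊢
    obtain ⟨hd, -, hf'⟩ := contDiff_succ_iff_deriv.1 hf
    have hc : Continuous f := hf.continuous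
    have hc' : Continuous (deriv f) := hf'.continuous
    have key : ∀ t, HasDerivAt (fun t => ∫ s in (0 : ℝ)..1, s ^ k • f (s * t))
        (∫ s in (0 : ℝ)..1, s ^ (k + 1) • deriv f (s * t)) t := by
      intro t
      obtain ⟨C, hC⟩ := ((isCompact_Icc (a := (0 : ℝ)) (b := 1)).prod
        (isCompact_closedBall t 1)).exists_bound_of_continuousOn
        (f := fun p : ℝ × ℝ => p.1 ^ (k + 1) • deriv f (p.1 * p.2)) (by fun_prop)
      refine (intervalIntegral.hasDerivAt_integral_of_dominated_loc_of_deriv_le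
        (F := fun t s : ℝ => s ^ k • f (s * t))
        (F' := fun t s : ℝ => s ^ (k + 1) • deriv f (s * t)) (bound := fun _ => C)
        (Metric.closedBall_mem_nhds t one_pos) (Eventually.of_forall fun x => ?_) ?_ ?_ ?_ ?_
        ?_).2
      · exact Continuous.aestronglyMeasurable (by fun_prop)
      · exact Continuous.intervalIntegrable (by fun_prop) _ _
      · exact Continuous.aestronglyMeasurable (by fun_prop)
      · refine Eventually.of_forall fun s hs x hx => hC (s, x) ⟨?_, hx⟩
        rw [Set.uIoc_of_le zero_le_one] at hs
        exact ⟨hs.1.le, hs.2⟩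
      · exact intervalIntegrable_const
      · refine Eventually.of_forall fun s _ x _ => ?_
        have h := ((hd (s * x)).hasDerivAt.scomp x
          (((hasDerivAt_id x).const_mul s))).const_smul (s ^ k)
        simp only [mul_one, smul_smul] at h
        rw [pow_succ]
        exact h
    refine contDiff_succ_iff_deriv.2 ⟨fun t => (key t).differentiableAt, by simp, ?_⟩
    rw [funext fun t => (key t).deriv]
    exact ih (k + 1) hf'

/-- Hadamard's lemma in one variable. -/
theorem ContDiff.exists_eq_add_smul {E : Type*} [NormedAddCommGroup E] [NormedSpace ℝ E]
    [CompleteSpace E] {f : ℝ → E} (hf : ContDiff ℝ ∞ f) :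
    ∃ h : ℝ → E, ContDiff ℝ ∞ h ∧ ∀ t, f t = f 0 + t • h t := by
  have hf' : ContDiff ℝ ∞ (deriv f) := (contDiff_infty_iff_deriv.1 hf).2
  have hc : Continuous (deriv f) := hf'.continuous
  refine ⟨fun t => ∫ s in (0 : ℝ)..1, deriv f (s * t), contDiff_infty.2 fun n => ?_, fun t => ?_⟩
  · simpa using contDiff_integral_pow_smul n 0 (contDiff_infty.1 hf' n)
  · have h := intervalIntegral.integral_eq_sub_of_hasDerivAt (a := 0) (b := 1)
      (f := fun s : ℝ => f (s * t)) (f' := fun s => t • deriv f (s * t)) (fun s _ => by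
        simpa [Function.comp_def] using
          ((contDiff_infty_iff_deriv.1 hf).1 (s * t)).hasDerivAt.scomp s
            ((hasDerivAt_id s).mul_const t)) (Continuous.intervalIntegrable (by fun_prop) _ _)
    rw [intervalIntegral.integral_smul] at h
    rw [h]
    simp

theorem iteratedDeriv_succ_id_mul {h : ℝ → ℝ} (hh : ContDiff ℝ ∞ h) (n : ℕ) :
    iteratedDeriv (n + 1) (fun t => t * h t) 0 = (n + 1) * iteratedDeriv n h 0 := by
  have e := iteratedDeriv_mul (n := n + 1) (x := (0 : ℝ)) (f := fun t : ℝ => t) (g := h)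
    contDiffAt_id (contDiff_infty.1 hh _).contDiffAt
  change iteratedDeriv (n + 1) (fun t => t * h t) 0 = _ at e
  have hz : ∀ m, iteratedDeriv (m + 2) (fun t : ℝ => t) 0 = 0 := fun m => by
    rw [iteratedDeriv_succ', iteratedDeriv_succ']; simp
  rw [e, Finset.sum_range_succ', Finset.sum_range_succ']
  simp [hz, iteratedDeriv_one]

theorem ContDiff.exists_taylor_remainder (k : ℕ) {f : ℝ → ℝ} (hf : ContDiff ℝ ∞ f) :
    ∃ R : ℝ → ℝ, ContDiff ℝ ∞ R ∧ ∀ t, f t =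
      ∑ i ∈ Finset.range k, iteratedDeriv i f 0 / i.factorial * t ^ i + t ^ k * R t := by
  induction k generalizing f with
  | zero => exact ⟨f, hf, by simp⟩
  | succ k ih =>
    obtain ⟨h, hh, hfh⟩ := hf.exists_eq_add_smul
    obtain ⟨R, hR, hhR⟩ := ih hh
    have e : ∀ i, iteratedDeriv (i + 1) f 0 = (i + 1) * iteratedDeriv i h 0 := fun i => by
      rw [← iteratedDeriv_succ_id_mul hh, show f = fun t => f 0 + t * h t from funext hfh,
        iteratedDeriv_const_add (by omega)]
    refine ⟨R, hR, fun t => ?_⟩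
    rw [hfh t, smul_eq_mul, hhR t, Finset.sum_range_succ', mul_add, Finset.mul_sum]
    simp only [e, Nat.factorial_succ, iteratedDeriv_zero]
    have : ∀ i ∈ Finset.range k, t * (iteratedDeriv i h 0 / (i.factorial : ℝ) * t ^ i) =
        (i + 1) * iteratedDeriv i h 0 / (((i + 1) * i.factorial : ℕ) : ℝ) * t ^ (i + 1) :=
      fun i _ => by
        have := i.factorial_ne_zero
        push_cast
        field_simp
        ring
    rw [Finset.sum_congr rfl this]
    simp
    ring

theorem iteratedDeriv_pow_mul_eq_zero {ψ q : ℝ → ℝ} {a : ℝ} (hψ : ContDiffAt ℝ ∞ ψ a)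
    (hq : ContDiffAt ℝ ∞ q a) (hψ0 : ψ a = 0) {n k : ℕ} (hn : n < k) :
    iteratedDeriv n (ψ ^ k * q) a = 0 := by
  induction k generalizing n with
  | zero => omega
  | succ k ih =>
    have hk : ContDiffAt ℝ ∞ (ψ ^ k * q) a := (hψ.pow k).mul hq
    rw [pow_succ', mul_assoc, iteratedDeriv_mul (contDiffAt_infty.1 hψ n) (contDiffAt_infty.1 hk n)]
    refine Finset.sum_eq_zero fun i hi => ?_
    rcases i.eq_zero_or_pos with rfl | hi0
    · simp [hψ0]
    · have := Finset.mem_range.1 hi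
      rw [ih (by omega), mul_zero]

theorem iteratedDeriv_eq_of_eventuallyEq_add_pow_mul {u v ψ q : ℝ → ℝ} {a : ℝ} {k : ℕ}
    (hv : ContDiffAt ℝ ∞ v a) (hψ : ContDiffAt ℝ ∞ ψ a) (hq : ContDiffAt ℝ ∞ q a)
    (hψ0 : ψ a = 0) (hu : u =ᶠ[𝓝 a] v + ψ ^ k * q) {n : ℕ} (hn : n < k) :
    iteratedDeriv n u a = iteratedDeriv n v a := by
  have hk : ContDiffAt ℝ ∞ (ψ ^ k * q) a := (hψ.pow k).mul hq
  rw [hu.iteratedDeriv_eq, iteratedDeriv_add (contDiffAt_infty.1 hv n) (contDiffAt_infty.1 hk n),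
    iteratedDeriv_pow_mul_eq_zero hψ hq hψ0 hn, add_zero]

theorem iteratedDeriv_add_of_eventuallyEq {u v : ℝ → ℝ} {a : ℝ} {k : ℕ}
    (h : iteratedDeriv k u =ᶠ[𝓝 a] v) (m : ℕ) :
    iteratedDeriv (m + k) u a = iteratedDeriv m v a := by
  rw [← h.iteratedDeriv_eq, iteratedDeriv_eq_iterate, iteratedDeriv_eq_iterate,
    iteratedDeriv_eq_iterate, Function.iterate_add_apply]

theorem eq_zero_of_reparametrized_jets {g ψ b x y z q₁ q₂ q₃ : ℝ → ℝ}
    (hg : ContDiffAt ℝ ∞ g 0) (hψ : ContDiffAt ℝ ∞ ψ 0) (hb : ContDiffAt ℝ ∞ b 0)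
    (hq₁ : ContDiffAt ℝ ∞ q₁ 0) (hq₂ : ContDiffAt ℝ ∞ q₂ 0) (hq₃ : ContDiffAt ℝ ∞ q₃ 0)
    (hg0 : g 0 ≠ 0) (hψ0 : ψ 0 = 0) (hψ' : iteratedDeriv 1 ψ 0 ≠ 0)
    (hx : x =ᶠ[𝓝 0] g + ψ ^ 4 * q₁) (hy : y =ᶠ[𝓝 0] g * ψ + ψ ^ 5 * q₂)
    (hz : z =ᶠ[𝓝 0] g * (ψ * ψ) + ψ ^ 6 * q₃)
    (hx3 : iteratedDeriv 3 x =ᶠ[𝓝 0] fun t => b t * x t)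
    (hy3 : iteratedDeriv 3 y =ᶠ[𝓝 0] fun t => b t * y t)
    (hz3 : iteratedDeriv 3 z =ᶠ[𝓝 0] fun t => b t * z t) : b 0 = 0 := by
  have hP := hψ.mul hψ
  have hgψ := hg.mul hψ
  have hgP := hg.mul hP
  have hyS : ContDiffAt ℝ ∞ y 0 := (hgψ.add ((hψ.pow 5).mul hq₂)).congr_of_eventuallyEq hy
  have hzS : ContDiffAt ℝ ∞ z 0 := (hgP.add ((hψ.pow 6).mul hq₃)).congr_of_eventuallyEq hz
  have X n (hn : n < 4) := iteratedDeriv_eq_of_eventuallyEq_add_pow_mul hg hψ hq₁ hψ0 hx hn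
  have Y n (hn : n < 5) := iteratedDeriv_eq_of_eventuallyEq_add_pow_mul hgψ hψ hq₂ hψ0 hy hn
  have Z n (hn : n < 6) := iteratedDeriv_eq_of_eventuallyEq_add_pow_mul hgP hψ hq₃ hψ0 hz hn
  have L n {u v : ℝ → ℝ} (hu : ContDiffAt ℝ ∞ u 0) (hv : ContDiffAt ℝ ∞ v 0) :
      iteratedDeriv n (fun t => u t * v t) 0 = ∑ i ∈ Finset.range (n + 1),
        n.choose i * iteratedDeriv i u 0 * iteratedDeriv (n - i) v 0 :=
    iteratedDeriv_mul (n := n) (contDiffAt_infty.1 hu n) (contDiffAt_infty.1 hv n)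
  have X3 := hx3.self_of_nhds
  have Y3 := hy3.self_of_nhds
  have Z3 := hz3.self_of_nhds
  have Y4 := iteratedDeriv_add_of_eventuallyEq hy3 1
  have Z4 := iteratedDeriv_add_of_eventuallyEq hz3 1
  have Z5 := iteratedDeriv_add_of_eventuallyEq hz3 2
  have X0 := X 0 (by norm_num)
  have Y0 := Y 0 (by norm_num)
  have Z0 := Z 0 (by norm_num)
  simp only [iteratedDeriv_zero] at X0 Y0 Z0
  rw [L _ hb hyS] at Y4
  rw [L _ hb hzS] at Z4 Z5
  norm_num [X, Y, Z, X0, Y0, Z0, L _ hg hψ, L _ hg hP, L _ hψ hψ,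
    Finset.sum_range_succ, Finset.sum_range_zero, iteratedDeriv_zero, hψ0, Nat.choose,
    -iteratedDeriv_one, -mul_eq_zero, -iteratedDeriv_mul_const_field] at X3 Y3 Z3 Y4 Z4 Z5
  generalize iteratedDeriv 1 ψ 0 = a at *
  generalize iteratedDeriv 2 ψ 0 = a₂ at *
  generalize iteratedDeriv 3 ψ 0 = a₃ at *
  generalize iteratedDeriv 4 ψ 0 = a₄ at *
  generalize iteratedDeriv 1 g 0 = g₁ at *
  generalize iteratedDeriv 2 g 0 = g₂ at *
  generalize iteratedDeriv 3 g 0 = g₃ at *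
  obtain ⟨s, rfl⟩ : ∃ s, g₁ = s * g 0 := ⟨g₁ / g 0, by field_simp⟩
  generalize g 0 = g₀ at *
  obtain rfl : a₂ = -(s * a) := by
    refine mul_left_cancel₀ (mul_ne_zero hg0 hψ') ?_
    linear_combination Z3 / 6
  obtain rfl : g₂ = s ^ 2 * g₀ / 2 := by
    refine mul_left_cancel₀ (mul_ne_zero hψ' hψ') ?_
    linear_combination (8 * a * Y3 - Z4) / 12
  obtain rfl : a₃ = 3 / 2 * a * s ^ 2 := by
    refine mul_left_cancel₀ hg0 ?_
    linear_combination Y3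
  refine (mul_eq_zero_iff_right (mul_ne_zero hg0 (mul_ne_zero hψ' hψ'))).1 ?_
  linear_combination (10 * a * Y4 - Z5) / 12 - 20 * a ^ 2 * X3 / 12

theorem ContinuousLinearMap.iteratedDeriv_comp_left {E F : Type*} [NormedAddCommGroup E]
    [NormedSpace ℝ E] [NormedAddCommGroup F] [NormedSpace ℝ F] (L : E →L[ℝ] F) {f : ℝ → E}
    {x : ℝ} {n : ℕ} (hf : ContDiffAt ℝ n f x) :
    iteratedDeriv n (fun t => L (f t)) x = L (iteratedDeriv n f x) := by
  have h := L.iteratedFDeriv_comp_left hf (i := n) le_rfl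
  change iteratedFDeriv ℝ n (fun t => L (f t)) x = _ at h
  rw [iteratedDeriv_eq_iteratedFDeriv, h]
  rfl

theorem LinearMap.exists_continuousLinearMap_comp_eq {V W : Type*} [AddCommGroup V] [Module ℝ V]
    [NormedAddCommGroup W] [NormedSpace ℝ W] [FiniteDimensional ℝ W] {p : V →ₗ[ℝ] W}
    (hp : Function.Surjective p) {μ : V →ₗ[ℝ] ℝ} (hμ : LinearMap.ker p ≤ LinearMap.ker μ) :
    ∃ L : W →L[ℝ] ℝ, ∀ v, L (p v) = μ v := by
  obtain ⟨s, hs⟩ := p.exists_rightInverse_of_surjective (LinearMap.range_eq_top.2 hp)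
  refine ⟨LinearMap.toContinuousLinearMap (μ ∘ₗ s), fun v => ?_⟩
  have h : s (p v) - v ∈ LinearMap.ker p := by
    simpa [sub_eq_zero] using LinearMap.congr_fun hs (p v)
  simpa [sub_eq_zero] using hμ h

/-- If `f t = t * h t` solves `f⁽⁴⁾ = B f` and, among `f'(0)`, `f''(0)`, `f⁽³⁾(0)`, only
`f⁽ʲ⁺¹⁾(0) = (j + 1)!` is nonzero, then `h` agrees with `t ^ j` up to order `j + 4`. -/
theorem exists_eq_pow_add_of_iteratedDeriv_four {f h B : ℝ → ℝ} (hh : ContDiff ℝ ∞ h)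
    (hB : ContDiffAt ℝ ∞ B 0) (hfh : f =ᶠ[𝓝 0] fun t => t * h t)
    (hf4 : iteratedDeriv 4 f =ᶠ[𝓝 0] fun t => B t * f t) {j : ℕ} (hj : j < 3)
    (hf : ∀ i < 3, iteratedDeriv (i + 1) f 0 = if i = j then ((j + 1).factorial : ℝ) else 0) :
    ∃ R : ℝ → ℝ, ContDiff ℝ ∞ R ∧ ∀ t, h t = t ^ j + t ^ (j + 4) * R t := by
  have e (n : ℕ) : iteratedDeriv (n + 1) f 0 = (n + 1) * iteratedDeriv n h 0 := by
    rw [hfh.iteratedDeriv_eq, iteratedDeriv_succ_id_mul hh]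
  have hfS : ContDiffAt ℝ ∞ f 0 := (contDiff_id.mul hh).contDiffAt.congr_of_eventuallyEq hfh
  have f0 : f 0 = 0 := by simpa using hfh.self_of_nhds
  have f4 (m : ℕ) : iteratedDeriv (m + 4) f 0 = ∑ i ∈ Finset.range (m + 1),
      m.choose i * iteratedDeriv i B 0 * iteratedDeriv (m - i) f 0 := by
    rw [iteratedDeriv_add_of_eventuallyEq hf4]
    exact iteratedDeriv_mul (contDiffAt_infty.1 hB m) (contDiffAt_infty.1 hfS m)
  obtain ⟨R, hR, hhR⟩ := hh.exists_taylor_remainder (j + 4)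
  refine ⟨R, hR, fun t => ?_⟩
  rw [hhR t]
  congr 1
  have h4 := f4 0
  have h5 := f4 1
  have h6 := f4 2
  have k0 := hf 0 (by norm_num)
  have k1 := hf 1 (by norm_num)
  have k2 := hf 2 (by norm_num)
  norm_num [Finset.sum_range_succ, f0, -iteratedDeriv_one] at h4 h5 h6 k0 k1 k2
  have e0 := e 0
  have e1 := e 1
  have e2 := e 2
  have e3 := e 3
  have e4 := e 4
  have e5 := e 5
  norm_num [-iteratedDeriv_one] at e0 e1 e2 e3 e4 e5
  rw [h4] at e3
  rw [h5] at e4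
  rw [h6] at e5
  interval_cases j
  all_goals
    simp [-iteratedDeriv_one, Nat.factorial] at k0 k1 k2
    simp [-iteratedDeriv_one, Finset.sum_range_succ, Nat.factorial]
    simp [-iteratedDeriv_one, k0, k1, k2] at e0 e1 e2 e3 e4 e5
  · rw [← e0, e1, e2, e3]
    ring
  · rw [← e0, e1, e2, e3, e4]
    ring
  · rw [← e0, e1, e3, e4, e5]
    linear_combination -(t ^ 2 / 6) * e2


end

/-- Proposition 5.1, first claim: `ε` is a canonical representative, with respect to a
projective parameter, of a regular curve in `ℙV` (`dim V = 4`) with Lagrangian osculating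
2-planes (`ω(ε, ε') = 0`, `ε⁽⁴⁾ = B₀ε`); `η` represents its reduction by `ℓ = ℝε(0)`, and
`ζ(τ) = g(τ)η(ψ(τ))` is a canonical representative of the reduction with respect to a
projective parameter (`ζ⁽³⁾ = b₀ζ`). Then the Wilczynski invariant `b₀(τ)(dτ)³` of the
reduction vanishes at the point corresponding to `ℓ`: `b₀(0) = 0`.
The quotient `V/ℓ` is modelled by a normed space `W` with a surjective linear map
`proj : V → W` whose kernel is `span{ε(0)}`. -/
theorem reduction_wilczynski_vanishes
    {V : Type*} [NormedAddCommGroup V] [NormedSpace ℝ V] [FiniteDimensional ℝ V]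
    {W : Type*} [NormedAddCommGroup W] [NormedSpace ℝ W]
    (hdim : Module.finrank ℝ V = 4)
    (ω : V →ₗ[ℝ] V →ₗ[ℝ] ℝ) (halt : ∀ v : V, ω v v = 0)
    (hnd : ∀ v : V, (∀ w : V, ω v w = 0) → v = 0)
    (I : Set ℝ) (hIopen : IsOpen I) (hIconn : I.OrdConnected) (h0I : (0 : ℝ) ∈ I)
    (ε : ℝ → V) (hε : ContDiffOn ℝ (⊤ : ℕ∞) ε I)
    (hreg : ∀ t ∈ I,
      LinearIndependent ℝ (fun i : Fin 4 => iteratedDerivWithin (i : ℕ) ε I t) ∧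
      Submodule.span ℝ (Set.range fun i : Fin 4 => iteratedDerivWithin (i : ℕ) ε I t) = ⊤)
    (hlag : ∀ t ∈ I, ω (ε t) (iteratedDerivWithin 1 ε I t) = 0)
    (B₀ : ℝ → ℝ) (hB₀ : ContDiffOn ℝ (⊤ : ℕ∞) B₀ I)
    (hcan : ∀ t ∈ I, iteratedDerivWithin 4 ε I t = B₀ t • ε t)
    (proj : V →ₗ[ℝ] W) (hsurj : Function.Surjective proj)
    (hker : LinearMap.ker proj = Submodule.span ℝ {ε 0})
    (η : ℝ → W)
    (hη : ∀ t ≠ (0 : ℝ), η t = t⁻¹ • proj (ε t))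
    (hη₀ : η 0 = proj (iteratedDerivWithin 1 ε I 0))
    (J : Set ℝ) (hJopen : IsOpen J) (hJconn : J.OrdConnected) (h0J : (0 : ℝ) ∈ J)
    (ψ : ℝ → ℝ) (hψ : ContDiffOn ℝ (⊤ : ℕ∞) ψ J) (hψJI : Set.MapsTo ψ J I)
    (hψ0 : ψ 0 = 0) (hψ' : ∀ τ ∈ J, derivWithin ψ J τ ≠ 0)
    (g : ℝ → ℝ) (hg : ContDiffOn ℝ (⊤ : ℕ∞) g J) (hg0 : ∀ τ ∈ J, g τ ≠ 0)
    (b₀ : ℝ → ℝ) (hb₀ : ContDiffOn ℝ (⊤ : ℕ∞) b₀ J)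
    (hcant : ∀ τ ∈ J, iteratedDerivWithin 3 (fun σ => g σ • η (ψ σ)) J τ =
      b₀ τ • (g τ • η (ψ τ))) :
    b₀ 0 = 0 := by
  have hIU := fun n => iteratedDerivWithin_of_isOpen (n := n) (f := ε) hIopen
  have hInhds := hIopen.mem_nhds h0I
  have hJnhds := hJopen.mem_nhds h0J
  have : FiniteDimensional ℝ W := Module.Finite.of_surjective proj hsurj
  have : CompleteSpace W := FiniteDimensional.complete ℝ W
  let p : V →L[ℝ] W := LinearMap.toContinuousLinearMap proj
  have hεS : ContDiffAt ℝ (⊤ : ℕ∞) ε 0 := hε.contDiffAt hInhds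
  have hψS : ContDiffAt ℝ (⊤ : ℕ∞) ψ 0 := hψ.contDiffAt hJnhds
  have hgS : ContDiffAt ℝ (⊤ : ℕ∞) g 0 := hg.contDiffAt hJnhds
  have hbS : ContDiffAt ℝ (⊤ : ℕ∞) b₀ 0 := hb₀.contDiffAt hJnhds
  have hBS : ContDiffAt ℝ (⊤ : ℕ∞) B₀ 0 := hB₀.contDiffAt hInhds
  have pε0 : proj (ε 0) = 0 := by
    rw [← LinearMap.mem_ker, hker]
    exact Submodule.mem_span_singleton_self _
  -- `η` coincides near `0` with a smooth function `H`
  obtain ⟨F, hF, hFε⟩ := hε.exists_contDiff_eventuallyEq hIopen h0I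
  obtain ⟨H, hH, hHF⟩ := (p.contDiff.comp hF).exists_eq_add_smul
  have hpH : ∀ᶠ t in 𝓝 0, proj (ε t) = t • H t := by
    filter_upwards [hFε] with t ht
    have h := hHF t
    simp only [Function.comp_apply, ht, hFε.self_of_nhds] at h
    simpa [p, pε0] using h
  have hH0 : H 0 = proj (iteratedDerivWithin 1 ε I 0) := by
    rw [hIU 1 h0I, iteratedDeriv_one]
    have h₁ : HasDerivAt (fun t => p (ε t)) (p (deriv ε 0)) 0 :=
      p.hasFDerivAt.comp_hasDerivAt 0 (hεS.differentiableAt (by simp)).hasDerivAt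
    have h₂ : HasDerivAt (fun t => p (ε t)) (H 0) 0 := by
      have h := (hasDerivAt_id (0 : ℝ)).smul (hH.differentiable (by simp) 0).hasDerivAt
      simp only [id, zero_smul, one_smul, zero_add] at h
      exact h.congr_of_eventuallyEq hpH
    exact h₂.unique h₁
  have hηH : η =ᶠ[𝓝 0] H := by
    filter_upwards [hpH] with t ht
    rcases eq_or_ne t 0 with rfl | h0
    · rw [hη₀, hH0]
    · rw [hη t h0, ht, inv_smul_smul₀ h0]
  have hψt : Tendsto ψ (𝓝 0) (𝓝 0) := by
    simpa [ContinuousAt, hψ0] using hψS.continuousAt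
  have hζH : (fun τ => g τ • η (ψ τ)) =ᶠ[𝓝 0] fun τ => g τ • H (ψ τ) := by
    filter_upwards [hψt.eventually hηH] with τ h
    rw [h]
  have hζS : ContDiffAt ℝ (⊤ : ℕ∞) (fun τ => g τ • η (ψ τ)) 0 :=
    (hgS.smul (hH.contDiffAt.comp 0 hψS)).congr_of_eventuallyEq hζH
  -- scalar coordinates of the reduction
  let e : Module.Basis (Fin 4) ℝ V := Module.Basis.mk (hreg 0 h0I).1 (hreg 0 h0I).2.ge
  have he (i : Fin 4) : e i = iteratedDeriv i ε 0 := by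
    simp only [e, Module.Basis.mk_apply]
    exact hIU i h0I
  have coord (j : ℕ) (hj : j < 3) : ∃ u R : ℝ → ℝ, ContDiff ℝ (⊤ : ℕ∞) R ∧
      iteratedDeriv 3 u =ᶠ[𝓝 0] (fun τ => b₀ τ * u τ) ∧
      u =ᶠ[𝓝 0] fun τ => g τ * (ψ τ ^ j + ψ τ ^ (j + 4) * R (ψ τ)) := by
    have hμ0 : e.coord ⟨j + 1, by omega⟩ (ε 0) = 0 := by
      have h := he 0
      simp only [Fin.val_zero, iteratedDeriv_zero] at h
      rw [← h, Module.Basis.coord_apply, e.repr_self, Finsupp.single_apply, if_neg]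
      simp [Fin.ext_iff]
    obtain ⟨L, hL⟩ := LinearMap.exists_continuousLinearMap_comp_eq hsurj
      (μ := ((j + 1).factorial : ℝ) • e.coord ⟨j + 1, by omega⟩) (by
        rw [hker, Submodule.span_singleton_le_iff_mem]
        simp only [LinearMap.mem_ker, LinearMap.smul_apply, hμ0, smul_zero])
    have hLe (n : ℕ) {t : ℝ} (ht : ContDiffAt ℝ n ε t) :
        iteratedDeriv n (fun t => L (p (ε t))) t = L (p (iteratedDeriv n ε t)) :=
      (L.comp p).iteratedDeriv_comp_left ht
    obtain ⟨R, hR, hLR⟩ := exists_eq_pow_add_of_iteratedDeriv_four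
      (f := fun t => L (p (ε t))) (h := fun t => L (H t)) (L.contDiff.comp hH) hBS (by
        filter_upwards [hpH] with t ht
        change L (proj (ε t)) = _
        simp [ht]) (by
        filter_upwards [(contDiffAt_infty.1 hεS 4).eventually (by simp), hInhds] with t ht hI
        rw [hLe 4 ht, ← hIU 4 hI, hcan t hI]
        simp) hj (fun i hi => by
        have h := he ⟨i + 1, by omega⟩
        rw [hLe _ (contDiffAt_infty.1 hεS _), ← h]
        change L (proj _) = _
        rw [hL, LinearMap.smul_apply, Module.Basis.coord_apply, e.repr_self,
          Finsupp.single_apply]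
        simp [Fin.ext_iff])
    refine ⟨fun τ => L (g τ • η (ψ τ)), R, hR, ?_, ?_⟩
    · filter_upwards [(contDiffAt_infty.1 hζS 3).eventually (by simp), hJnhds] with τ hτ hJ
      rw [L.iteratedDeriv_comp_left hτ, ← iteratedDerivWithin_of_isOpen hJopen hJ, hcant τ hJ,
        map_smul, smul_eq_mul]
    · filter_upwards [hζH] with τ hτ
      rw [hτ, map_smul, hLR, smul_eq_mul]
  obtain ⟨x, R₁, hR₁, hx3, hx⟩ := coord 0 (by norm_num)
  obtain ⟨y, R₂, hR₂, hy3, hy⟩ := coord 1 (by norm_num)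
  obtain ⟨z, R₃, hR₃, hz3, hz⟩ := coord 2 (by norm_num)
  refine eq_zero_of_reparametrized_jets hgS hψS hbS
    (hgS.mul (hR₁.contDiffAt.comp 0 hψS)) (hgS.mul (hR₂.contDiffAt.comp 0 hψS))
    (hgS.mul (hR₃.contDiffAt.comp 0 hψS)) (hg0 0 h0J) hψ0 ?_ (hx.trans (.of_eq ?_))
    (hy.trans (.of_eq ?_)) (hz.trans (.of_eq ?_)) hx3 hy3 hz3
  · rw [iteratedDeriv_one, ← derivWithin_of_isOpen hJopen h0J]
    exact hψ' 0 h0J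
  all_goals
    ext τ
    simp
    try ring
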